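/- Let k ≥ 3, let r be an integer with -1 ≤ r ≤ k-2, let m be an integer with m ≥ k-2, and set l = ⌊(m+1)/(k-1)⌋. Then, as rational numbers, L_{-(mk+r)}^{(k)} = Σ_{i=0}^{l} (-1)^(ik+r) · ( ψ(m-i-1, ik+r-1)·2^(m-i(k+1)-r) + ψ(m-i-1, ik+r)·2^(m-i(k+1)-r-2) ). -/

import Mathlib

/-- `L : ℤ → ℤ` is the `k`-generalized Lucas sequence: it satisfies the order-`k`
recurrence everywhere, with `L 0 = 2`, `L 1 = 1`, and `L n = 0` for `-(k-2) ≤ n ≤ -1`. -/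
def IsGenLucas (k : ℕ) (L : ℤ → ℤ) : Prop :=
  (∀ n : ℤ, L n = ∑ i ∈ Finset.Icc 1 k, L (n - (i : ℤ))) ∧
  L 0 = 2 ∧ L 1 = 1 ∧ ∀ n : ℤ, -((k : ℤ) - 2) ≤ n → n ≤ -1 → L n = 0

/-- Extended binomial coefficient: `C a b = a.choose b` when `0 ≤ b ≤ a`, and `0` otherwise. -/
def C (a b : ℤ) : ℤ := if 0 ≤ b ∧ b ≤ a then (a.toNat).choose b.toNat else 0

/-- `ψ(y, z) = C(y, z) + C(y+1, z+1)`. -/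
def psi (y z : ℤ) : ℤ := C y z + C (y + 1) (z + 1)

theorem C_eq_zero_of_lt {a b : ℤ} (h : a < b) : C a b = 0 :=
  if_neg (by omega)

theorem C_eq_zero_of_neg {a b : ℤ} (h : b < 0) : C a b = 0 :=
  if_neg (by omega)

/-- Pascal's rule for the extended binomial coefficients. -/
theorem C_succ_succ {a b : ℤ} (h : 0 ≤ a ∨ 0 ≤ b) :
    C (a + 1) (b + 1) = C a b + C a (b + 1) := by
  rcases lt_or_ge a 0 with ha | ha
  · rw [C_eq_zero_of_lt (by omega), C_eq_zero_of_lt (by omega), C_eq_zero_of_lt (by omega)]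
    rfl
  rcases lt_or_ge b (-1) with hb | hb
  · rw [C_eq_zero_of_neg (by omega), C_eq_zero_of_neg (by omega), C_eq_zero_of_neg (by omega)]
    rfl
  obtain ⟨n, rfl⟩ := Int.eq_ofNat_of_zero_le ha
  rcases hb.eq_or_lt with rfl | hb
  · simp [C]; omega
  obtain ⟨j, rfl⟩ := Int.eq_ofNat_of_zero_le (show 0 ≤ b by omega)
  have key (x y : ℕ) : C x y = x.choose y := by
    unfold C
    split_ifs with h
    · simp
    · rw [Nat.choose_eq_zero_of_lt (by omega)]; rfl
  have := Nat.choose_succ_succ n j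
  have h1 := key (n + 1) (j + 1)
  have h2 := key n (j + 1)
  push_cast at h1 h2
  rw [h1, h2, key]
  exact_mod_cast this

theorem psi_eq_zero_of_lt {y z : ℤ} (h : y < z) : psi y z = 0 := by
  rw [psi, C_eq_zero_of_lt h, C_eq_zero_of_lt (by omega), add_zero]

theorem psi_eq_zero_of_lt_neg_one {y z : ℤ} (h : z < -1) : psi y z = 0 := by
  rw [psi, C_eq_zero_of_neg (by omega), C_eq_zero_of_neg (by omega), add_zero]

theorem psi_succ_succ {y z : ℤ} (h : 0 ≤ y ∨ 0 ≤ z) :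
    psi (y + 1) (z + 1) = psi y z + psi y (z + 1) := by
  have h1 := C_succ_succ h
  have h2 := C_succ_succ (a := y + 1) (b := z + 1) (by omega)
  rw [psi, psi, psi]
  linarith

/-- The summand of the formula, in the variables `p = m - i` and `j = i * k + r`. -/
def lucasTerm (p j : ℤ) : ℚ :=
  (-1) ^ j * (psi (p - 1) (j - 1) * 2 ^ (p - j) + psi (p - 1) j * 2 ^ (p - j - 2))

theorem lucasTerm_eq_zero_of_lt {p j : ℤ} (h : p < j) : lucasTerm p j = 0 := by
  simp [lucasTerm, psi_eq_zero_of_lt (show p - 1 < j - 1 by omega),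
    psi_eq_zero_of_lt (show p - 1 < j by omega)]

theorem lucasTerm_eq_zero_of_lt_neg_one {p j : ℤ} (h : j < -1) : lucasTerm p j = 0 := by
  simp [lucasTerm, psi_eq_zero_of_lt_neg_one (show j - 1 < -1 by omega),
    psi_eq_zero_of_lt_neg_one h]

theorem lucasTerm_succ {p j : ℤ} (h : 1 ≤ p ∨ 2 ≤ j) :
    lucasTerm (p + 1) j = 2 * lucasTerm p j - lucasTerm p (j - 1) := by
  have h1 := psi_succ_succ (y := p - 1) (z := j - 2) (by omega)
  have h2 := psi_succ_succ (y := p - 1) (z := j - 1) (by omega)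
  rw [show p - 1 + 1 = p + 1 - 1 by ring, show j - 2 + 1 = j - 1 by ring] at h1
  rw [show p - 1 + 1 = p + 1 - 1 by ring, show j - 1 + 1 = j by ring] at h2
  have e1 : (2 : ℚ) ^ (p + 1 - j) = 4 * 2 * 2 ^ (p - j - 2) := by
    rw [show p + 1 - j = (p - j - 2) + 2 + 1 by ring, zpow_add₀ two_ne_zero,
      zpow_add₀ two_ne_zero]
    norm_num; ring
  have e2 : (2 : ℚ) ^ (p - j) = 4 * 2 ^ (p - j - 2) := by
    rw [show p - j = (p - j - 2) + 2 by ring, zpow_add₀ two_ne_zero]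
    norm_num; ring
  have e3 : (2 : ℚ) ^ (p + 1 - j - 2) = 2 * 2 ^ (p - j - 2) := by
    rw [show p + 1 - j - 2 = (p - j - 2) + 1 by ring, zpow_add₀ two_ne_zero]
    norm_num; ring
  have e4 : (-1 : ℚ) ^ (j - 1) = -(-1) ^ j := by
    rw [zpow_sub₀ (by norm_num), zpow_one, div_neg, div_one]
  simp only [lucasTerm, h1, h2, show p - (j - 1) = p + 1 - j by ring,
    show j - 1 - 1 = j - 2 by ring, e1, e2, e3, e4]
  push_cast
  ring

/-- The partial sums of the right-hand side of the formula. -/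
def lucasSum (k : ℕ) (N : ℕ) (m r : ℤ) : ℚ :=
  ∑ i ∈ Finset.range (N + 1), lucasTerm (m - i) (i * k + r)

theorem lucasSum_succ {k : ℕ} (hk : 3 ≤ k) (N : ℕ) {m r : ℤ} (hm : 1 ≤ m) (hr : -1 ≤ r) :
    lucasSum k N (m + 1) r = 2 * lucasSum k N m r - lucasSum k N m (r - 1) := by
  simp only [lucasSum, Finset.mul_sum, ← Finset.sum_sub_distrib]
  refine Finset.sum_congr rfl fun i _ => ?_
  have : 1 ≤ m - (i : ℤ) ∨ 2 ≤ (i : ℤ) * k + r := by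
    rcases Nat.eq_zero_or_pos i with rfl | hi
    · left; simpa using hm
    · right; nlinarith
  rw [show m + 1 - (i : ℤ) = m - i + 1 by ring, lucasTerm_succ this, add_sub_assoc]

theorem lucasSum_neg_two (k : ℕ) (N : ℕ) (m : ℤ) :
    lucasSum k (N + 1) (m + 1) (-2) = lucasSum k N m (k - 2) := by
  rw [lucasSum, Finset.sum_range_succ', lucasTerm_eq_zero_of_lt_neg_one (by simp), add_zero,
    lucasSum]
  refine Finset.sum_congr rfl fun i _ => ?_
  congr 1 <;> push_cast <;> ring

theorem lucasSum_one {k : ℕ} (hk : 3 ≤ k) (N : ℕ) {r : ℤ} (hr : -2 ≤ r) :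
    lucasSum k N 1 r = lucasTerm 1 r := by
  rw [lucasSum, Finset.sum_range_succ', Finset.sum_eq_zero]
  · simp
  · intro i _
    refine lucasTerm_eq_zero_of_lt ?_
    push_cast
    nlinarith

namespace IsGenLucas

variable {k : ℕ} {L : ℤ → ℤ}

theorem eq_sum_range (hL : IsGenLucas k L) (n : ℤ) :
    L n = ∑ i ∈ Finset.range k, L (n - 1 - i) := by
  rw [hL.1 n, ← Finset.Ico_add_one_right_eq_Icc, Finset.sum_Ico_eq_sum_range,
    Nat.add_sub_cancel]
  refine Finset.sum_congr rfl fun i _ => ?_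
  push_cast
  congr 1
  ring

theorem sub_order (hL : IsGenLucas k L) (n : ℤ) : L (n - k) = 2 * L n - L (n + 1) := by
  have h : ∑ i ∈ Finset.range (k + 1), L (n - i) = L n + L n := by
    rw [Finset.sum_range_succ', hL.eq_sum_range n]
    simp [hL.eq_sum_range n, sub_sub, add_comm]
  rw [Finset.sum_range_succ] at h
  have h' := hL.eq_sum_range (n + 1)
  rw [add_sub_cancel_right] at h'
  linarith

theorem one_sub_order (hL : IsGenLucas k L) (hk : 2 ≤ k) : L (1 - k) = -1 := by
  obtain ⟨n, rfl⟩ := Nat.exists_eq_add_of_le' hk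
  have h := hL.eq_sum_range 1
  rw [Finset.sum_range_succ, Finset.sum_range_succ', Finset.sum_eq_zero] at h
  · have e : (1 : ℤ) - 1 - ((n + 1 : ℕ) : ℤ) = 1 - ((n + 2 : ℕ) : ℤ) := by push_cast; ring
    rw [e, hL.2.2.1] at h
    have := hL.2.1
    simp only [Nat.cast_zero, sub_self] at h
    linarith
  · intro i hi
    have := Finset.mem_range.1 hi
    exact hL.2.2.2 _ (by push_cast; omega) (by push_cast; omega)

theorem neg_order_sub (hL : IsGenLucas k L) (hk : 3 ≤ k) {r : ℤ} (hr : -2 ≤ r)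
    (hr' : r ≤ (k : ℤ) - 2) : (L (-(k + r)) : ℚ) = lucasTerm 1 r := by
  obtain ⟨-, h0, h1, hz⟩ := id hL
  have hs (r : ℤ) : L (-(k + r)) = 2 * L (-r) - L (-r + 1) := by
    rw [← hL.sub_order]; congr 1; ring
  obtain rfl | rfl | rfl | rfl | hr : r = -2 ∨ r = -1 ∨ r = 0 ∨ r = 1 ∨ 2 ≤ r := by omega
  · rw [hz _ (by omega) (by omega), lucasTerm_eq_zero_of_lt_neg_one (by norm_num)]
    rfl
  · rw [show -((k : ℤ) + -1) = 1 - k by ring, hL.one_sub_order (by omega)]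
    norm_num [lucasTerm, psi, C]
  · rw [hs]
    norm_num [lucasTerm, psi, C, h0, h1]
  · rw [hs, hz (-1) (by omega) (by omega)]
    norm_num [lucasTerm, psi, C, h0]
  · rw [hs, hz _ (by omega) (by omega), hz _ (by omega) (by omega),
      lucasTerm_eq_zero_of_lt (by omega)]
    rfl

theorem neg_eq_lucasSum (hL : IsGenLucas k L) (hk : 3 ≤ k) (n : ℕ) :
    ∀ N, n ≤ N → ∀ r : ℤ, -2 ≤ r → r ≤ (k : ℤ) - 2 →
      (L (-(((n : ℤ) + 1) * k + r)) : ℚ) = lucasSum k N (n + 1) r := by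
  induction n with
  | zero =>
    intro N _ r hr hr'
    simpa [lucasSum_one hk N hr] using hL.neg_order_sub hk hr hr'
  | succ n ih =>
    intro N hN r hr hr'
    push_cast
    rcases hr.eq_or_lt with rfl | hr
    · obtain ⟨N, rfl⟩ := Nat.exists_eq_add_of_le' (show 1 ≤ N by omega)
      rw [lucasSum_neg_two, ← ih N (by omega) (k - 2) (by omega) le_rfl]
      congr 2
      ring
    · rw [lucasSum_succ hk N (by omega) (by omega), ← ih N (by omega) r (by omega) hr',
        ← ih N (by omega) (r - 1) (by omega) (by omega)]
      have h := hL.sub_order (-(((n : ℤ) + 1) * k + r))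
      rw [show -(((n : ℤ) + 1) * k + r) - k = -(((n : ℤ) + 1 + 1) * k + r) by ring,
        show -(((n : ℤ) + 1) * k + r) + 1 = -(((n : ℤ) + 1) * k + (r - 1)) by ring] at h
      exact_mod_cast h

end IsGenLucas

theorem value_general_formula (k : ℕ) (hk : 3 ≤ k) (L : ℤ → ℤ) (hL : IsGenLucas k L)
    (m r : ℤ) (hr1 : -1 ≤ r) (hr2 : r ≤ (k : ℤ) - 2) (hm : (k : ℤ) - 2 ≤ m) :
    (L (-(m * k + r)) : ℚ) =
      ∑ i ∈ Finset.Icc (0 : ℤ) ((m + 1) / ((k : ℤ) - 1)),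
        (-1 : ℚ) ^ (i * k + r) *
          ((psi (m - i - 1) (i * k + r - 1) : ℚ) * (2 : ℚ) ^ (m - i * ((k : ℤ) + 1) - r) +
            (psi (m - i - 1) (i * k + r) : ℚ) * (2 : ℚ) ^ (m - i * ((k : ℤ) + 1) - r - 2)) := by
  obtain ⟨n, rfl⟩ : ∃ n : ℕ, m = n + 1 := ⟨(m - 1).toNat, by omega⟩
  rw [hL.neg_eq_lucasSum hk n (n + 1) (by omega) r (by omega) hr2, lucasSum]
  have hk' : (0 : ℤ) < (k : ℤ) - 1 := by omega
  have hl : ((n : ℤ) + 1 + 1) / ((k : ℤ) - 1) < n + 2 :=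
    Int.ediv_lt_of_lt_mul hk' (by nlinarith [(by omega : (3 : ℤ) ≤ k)])
  have hIcc : ∑ i ∈ Finset.range (n + 1 + 1), lucasTerm ((n : ℤ) + 1 - i) (i * k + r) =
      ∑ i ∈ Finset.Ico (0 : ℤ) (n + 2), lucasTerm ((n : ℤ) + 1 - i) (i * k + r) := by
    refine Finset.sum_nbij' (fun i => (i : ℤ)) Int.toNat ?_ ?_ ?_ ?_ fun _ _ => rfl <;>
      simp only [Finset.mem_range, Finset.mem_Ico] <;> omega
  rw [hIcc]
  symm
  refine (Finset.sum_congr rfl fun i _ => ?_).trans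
    (Finset.sum_subset (f := fun i : ℤ => lucasTerm ((n : ℤ) + 1 - i) (i * k + r)) ?_ ?_)
  · rw [lucasTerm, show (n : ℤ) + 1 - i * (k + 1) - r = n + 1 - i - (i * k + r) by ring]
  · intro i hi
    simp only [Finset.mem_Icc, Finset.mem_Ico] at hi ⊢
    omega
  · intro i hi hi'
    simp only [Finset.mem_Icc, Finset.mem_Ico] at hi hi'
    have h := Int.lt_mul_of_ediv_lt hk' (show ((n : ℤ) + 1 + 1) / ((k : ℤ) - 1) < i by omega)
    exact lucasTerm_eq_zero_of_lt (by nlinarith)
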